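/- Let T be a Calderón–Zygmund operator with normalised standard kernel of Hölder exponent γ, and let r ∈ [1,∞). There is C depending only on n, γ, r such that for all I, J ∈ 𝒟 with ℓ(I) ≤ ℓ(J), all m ∈ ℤⁿ∖{0}, and all η ∈ {0,1}ⁿ∖{0}: ( (1/|J|) ∫_J |Σ_{K⊆J, ℓ(K)=ℓ(I)} ⟨h⁰_{J∔m}, T h^η_K⟩ h^η_K(x)|^r dx )^{1/r} ≤ C |J|^{−1/2} (ℓ(I)/ℓ(J))^{min(γ,1/r)} (1 + log(ℓ(J)/ℓ(I)))^{δ·(1/r)} (1+|m|)^{−n−γ}, where δ = 1 if γ = 1/r and δ = 0 otherwise, and the sum is over dyadic K ⊆ J with ℓ(K) = ℓ(I). -/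

import Mathlib

open MeasureTheory

noncomputable section

open Classical in
/-- Classical indicator of a proposition. -/
def indR (P : Prop) : ℝ := if P then 1 else 0

/-- The real sign associated to a boolean. -/
def sgnB (b : Bool) : ℝ := if b then 1 else -1

/-- The `ℓ∞` norm of an integer vector, as a real number. -/
def inorm {n : ℕ} (m : Fin n → ℤ) : ℝ := ‖(fun i => (m i : ℝ) : Fin n → ℝ)‖

/-- The dyadic cube `2^{-k}([0,1)^n + m)` of generation `k` in `ℝ^n` (with the `ℓ∞` metric). -/
def dyadicCube (n : ℕ) (k : ℤ) (m : Fin n → ℤ) : Set (Fin n → ℝ) :=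
  {x | ∀ i, (2:ℝ) ^ (-k) * m i ≤ x i ∧ x i < (2:ℝ) ^ (-k) * (m i + 1)}

/-- The side length `2^{-k}` of a dyadic cube of generation `k`. -/
def sideLen (k : ℤ) : ℝ := (2:ℝ) ^ (-k)

/-- One-dimensional Haar function on the dyadic interval `2^{-k}[m, m+1)`:
the non-cancellative `h⁰` for `η = false`, the cancellative `h¹` for `η = true`. -/
def haar1D (k : ℤ) (m : ℤ) (η : Bool) (t : ℝ) : ℝ :=
  (Real.sqrt ((2:ℝ) ^ (-k)))⁻¹ *
    (if η then
        (Set.Ico ((2:ℝ) ^ (-k) * m) ((2:ℝ) ^ (-k) * (m + 1/2))).indicator 1 t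
          - (Set.Ico ((2:ℝ) ^ (-k) * (m + 1/2)) ((2:ℝ) ^ (-k) * (m + 1))).indicator 1 t
      else (Set.Ico ((2:ℝ) ^ (-k) * m) ((2:ℝ) ^ (-k) * (m + 1))).indicator 1 t)

/-- The Haar function `h^η_I` for the dyadic cube `I` indexed by `(k, m)`. -/
def haarFn (n : ℕ) (k : ℤ) (m : Fin n → ℤ) (η : Fin n → Bool) (x : Fin n → ℝ) : ℝ :=
  ∏ i, haar1D k (m i) (η i) (x i)

/-- The non-cancellative Haar function `h⁰_I = |I|^{-1/2} 1_I`. -/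
def haarZero (n : ℕ) (k : ℤ) (m : Fin n → ℤ) : (Fin n → ℝ) → ℝ :=
  haarFn n k m (fun _ => false)

/-- The pairing `⟨g, f⟩ = ∫ g f dx`. -/
def pairing {n : ℕ} (g f : (Fin n → ℝ) → ℝ) : ℝ := ∫ x, g x * f x

/-- A normalised standard kernel with Hölder exponent `γ` (with respect to the `ℓ∞` metric). -/
structure IsNormalisedKernel (n : ℕ) (γ : ℝ) (K : (Fin n → ℝ) → (Fin n → ℝ) → ℝ) : Prop where
  size : ∀ x y, x ≠ y → |K x y| ≤ dist x y ^ (-(n:ℝ))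
  smooth : ∀ x y h, 2 * ‖h‖ < dist x y →
    |K (x + h) y - K x y| + |K x (y + h) - K x y| ≤ ‖h‖ ^ γ * dist x y ^ (-(n:ℝ) - γ)

/-- The singular integral `Tf(x) = ∫ K(x,y) f(y) dy`. -/
def czIntegral {n : ℕ} (K : (Fin n → ℝ) → (Fin n → ℝ) → ℝ) (f : (Fin n → ℝ) → ℝ)
    (x : Fin n → ℝ) : ℝ := ∫ y, K x y * f y

/-- The truncated singular integral `T_ε f(x) = ∫_{|y-x|>ε} K(x,y) f(y) dy`. -/
def czTrunc {n : ℕ} (K : (Fin n → ℝ) → (Fin n → ℝ) → ℝ) (ε : ℝ) (f : (Fin n → ℝ) → ℝ)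
    (x : Fin n → ℝ) : ℝ := ∫ y in {y | ε < dist x y}, K x y * f y

/-- The dyadic conditional expectation `E_k f`. -/
def dyadicE (n : ℕ) (k : ℤ) (f : (Fin n → ℝ) → ℝ) (x : Fin n → ℝ) : ℝ :=
  (2:ℝ) ^ (k * (n:ℤ)) * ∫ y in dyadicCube n k (fun i => ⌊(2:ℝ) ^ k * x i⌋), f y

/-- The dyadic martingale difference `D_k f = E_{k+1} f - E_k f`. -/
def dyadicD (n : ℕ) (k : ℤ) (f : (Fin n → ℝ) → ℝ) (x : Fin n → ℝ) : ℝ :=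
  dyadicE n (k+1) f x - dyadicE n k f x

/-- The centre of the dyadic cube indexed by `(k, m)`. -/
def cubeCenter (n : ℕ) (k : ℤ) (m : Fin n → ℤ) : Fin n → ℝ :=
  fun i => (2:ℝ) ^ (-k) * (m i + 1/2)

/-- The concentric `c`-fold expansion of the dyadic cube indexed by `(k, m)`. -/
def expandCube (n : ℕ) (k : ℤ) (m : Fin n → ℤ) (c : ℝ) : Set (Fin n → ℝ) :=
  {x | ∀ i, |x i - cubeCenter n k m i| ≤ c * (2:ℝ) ^ (-k) / 2}

/-- The set `Σ_{f,s} = ⋃_k 9Ω_k`, where `Ω_k` is the union of the cubes `I ∈ 𝒟_k` on which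
`D_{k+s} f` is not a.e. zero. -/
def SigmaSet (n : ℕ) (f : (Fin n → ℝ) → ℝ) (s : ℕ) : Set (Fin n → ℝ) :=
  ⋃ (k : ℤ) (m : Fin n → ℤ)
    (_ : ¬ (∀ᵐ x ∂(volume.restrict (dyadicCube n k m)), dyadicD n (k + (s:ℤ)) f x = 0)),
      expandCube n k m 9

/-- The (measure-theoretic) support of a measurable function: the complement of the union of
all balls on which the function vanishes a.e. -/
def suppAE {n : ℕ} (f : (Fin n → ℝ) → ℝ) : Set (Fin n → ℝ) :=
  {x | ∀ r > 0, ¬ (∀ᵐ y ∂(volume.restrict (Metric.ball x r)), f y = 0)}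

/-- The axis-parallel closed cube with centre `c` and side length `ρ`. -/
def cube (n : ℕ) (c : Fin n → ℝ) (ρ : ℝ) : Set (Fin n → ℝ) :=
  {x | ∀ i, |x i - c i| ≤ ρ / 2}

/-- The index of the `s`-th dyadic ancestor `I^{(s)}` of the cube indexed by `(k, m)`
(the ancestor is the cube indexed by `(k - s, ancestorIdx s m)`). -/
def ancestorIdx {n : ℕ} (s : ℕ) (m : Fin n → ℤ) : Fin n → ℤ :=
  fun i => Int.fdiv (m i) (2 ^ s)

/-- The distance between two sets (in the ambient metric). -/
def setDist {α : Type*} [PseudoMetricSpace α] (A B : Set α) : ℝ :=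
  sInf (Set.image2 dist A B)

lemma sum_range_succ_rpow_neg_le {p : ℝ} (hp0 : 0 < p) (hp : p < 1) (N : ℕ) :
    ∑ i ∈ Finset.range N, ((i : ℝ) + 1) ^ (-p) ≤ (N : ℝ) ^ (1 - p) / (1 - p) := by
  have hq : 0 < 1 - p := by linarith
  induction N with
  | zero => simp [Real.zero_rpow hq.ne']
  | succ N ih =>
    rw [Finset.sum_range_succ]
    have hN : (0 : ℝ) < (N : ℝ) + 1 := by positivity
    have hb : (1 + -(1 / ((N : ℝ) + 1))) ^ (1 - p) ≤ 1 + (1 - p) * (-(1 / ((N : ℝ) + 1))) := by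
      apply rpow_one_add_le_one_add_mul_self _ hq.le (by linarith)
      rw [neg_le_neg_iff, div_le_one hN]
      linarith [Nat.cast_nonneg (α := ℝ) N]
    have h1 : 1 + -(1 / ((N : ℝ) + 1)) = N / (N + 1) := by field_simp; ring
    rw [h1, Real.div_rpow (by positivity) hN.le, div_le_iff₀ (by positivity)] at hb
    have h2 : ((N : ℝ) + 1) ^ (-p) = ((N : ℝ) + 1) ^ (1 - p) / (N + 1) := by
      rw [show -p = (1 - p) - 1 by ring, Real.rpow_sub_one hN.ne']
    push_cast
    rw [le_div_iff₀ hq] at ih ⊢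
    rw [h2]
    have h3 : (1 + (1 - p) * -(1 / ((N : ℝ) + 1))) * ((N : ℝ) + 1) ^ (1 - p) =
      ((N : ℝ) + 1) ^ (1 - p) - ((N : ℝ) + 1) ^ (1 - p) / (N + 1) * (1 - p) := by
      field_simp; ring
    linarith

lemma sum_range_succ_inv_le (N : ℕ) :
    ∑ i ∈ Finset.range N, ((i : ℝ) + 1) ^ (-1 : ℝ) ≤ 1 + Real.log N := by
  have h := harmonic_le_one_add_log N
  simp only [harmonic, Rat.cast_sum, Rat.cast_inv, Rat.cast_natCast] at h
  simpa [Real.rpow_neg_one] using h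

lemma sum_range_succ_rpow_neg_le_tsum {p : ℝ} (hp : 1 < p) (N : ℕ) :
    ∑ i ∈ Finset.range N, ((i : ℝ) + 1) ^ (-p) ≤ ∑' i : ℕ, ((i : ℝ) + 1) ^ (-p) := by
  apply Summable.sum_le_tsum _ (fun i _ => by positivity)
  have h := (summable_nat_add_iff 1).2 (Real.summable_nat_rpow.2 (by linarith : -p < -1))
  simpa using h

/-- The averages of the powers `(i + 1)^{-γ r}` over `i < 2^d`, in all three regimes. -/
lemma exists_average_rpow_le {γ r : ℝ} (hγ : 0 < γ) (hr : 1 ≤ r) :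
    ∃ C : ℝ, 0 < C ∧ ∀ d : ℕ,
      ((2 ^ d : ℝ)⁻¹ * ∑ i ∈ Finset.range (2 ^ d), (((i : ℝ) + 1) ^ (-γ)) ^ r) ^ (1 / r) ≤
        C * ((2 : ℝ) ^ (-(d : ℝ))) ^ min γ (1 / r) *
          (1 + Real.log ((2 : ℝ) ^ d)) ^ (if γ = 1 / r then 1 / r else 0) := by
  have hr0 : 0 < r := by linarith
  have e1 : ∀ i : ℕ, (((i : ℝ) + 1) ^ (-γ)) ^ r = ((i : ℝ) + 1) ^ (-(γ * r)) := fun i => by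
    rw [← Real.rpow_mul (by positivity)]; ring_nf
  simp only [e1]
  have hd : ∀ d : ℕ, (2 : ℝ) ^ (-(d : ℝ)) = (2 ^ d : ℝ)⁻¹ := fun d => by
    rw [Real.rpow_neg two_pos.le, Real.rpow_natCast]
  simp only [hd]
  have hS : ∀ d : ℕ, 0 ≤ ∑ i ∈ Finset.range (2 ^ d), ((i : ℝ) + 1) ^ (-(γ * r)) := fun d =>
    Finset.sum_nonneg fun i _ => by positivity
  rcases lt_trichotomy γ (1 / r) with h | h | h
  · have hp : γ * r < 1 := by rwa [lt_div_iff₀ hr0] at h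
    refine ⟨((1 - γ * r)⁻¹) ^ (1 / r), Real.rpow_pos_of_pos (inv_pos.2 (by linarith)) _,
      fun d => ?_⟩
    rw [if_neg h.ne, Real.rpow_zero, mul_one, min_eq_left h.le]
    have h1 := sum_range_succ_rpow_neg_le (by positivity) hp (2 ^ d)
    have hq : 0 < 1 - γ * r := by linarith
    have h2 : (2 ^ d : ℝ)⁻¹ * ∑ i ∈ Finset.range (2 ^ d), ((i : ℝ) + 1) ^ (-(γ * r)) ≤
        (1 - γ * r)⁻¹ * ((2 ^ d : ℝ)⁻¹) ^ (γ * r) := by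
      calc _ ≤ (2 ^ d : ℝ)⁻¹ * (((2 ^ d : ℕ) : ℝ) ^ (1 - γ * r) / (1 - γ * r)) := by gcongr
        _ = _ := by
          push_cast
          rw [Real.rpow_sub (by positivity), Real.rpow_one, Real.inv_rpow (by positivity)]
          field_simp
    calc _ ≤ _ := Real.rpow_le_rpow (by have := hS d; positivity) h2 (by positivity)
      _ = _ := by
        rw [Real.mul_rpow (by positivity) (by positivity), ← Real.rpow_mul (by positivity)]
        congr 2
        field_simp
  · have hp : γ * r = 1 := by rw [h]; field_simp
    refine ⟨1, one_pos, fun d => ?_⟩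
    rw [if_pos h, hp, h, min_self, one_mul]
    have h1 := sum_range_succ_inv_le (2 ^ d)
    push_cast at h1
    have hlog : 0 ≤ Real.log ((2 : ℝ) ^ d) := Real.log_nonneg (one_le_pow₀ one_le_two)
    rw [← Real.mul_rpow (by positivity) (by positivity)]
    have := hS d
    rw [hp] at this
    gcongr
  · have hp : 1 < γ * r := by rwa [div_lt_iff₀ hr0] at h
    have hT := sum_range_succ_rpow_neg_le_tsum hp 1
    have hT0 : 0 < ∑' i : ℕ, ((i : ℝ) + 1) ^ (-(γ * r)) := by
      refine lt_of_lt_of_le ?_ hT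
      simp
    refine ⟨(∑' i : ℕ, ((i : ℝ) + 1) ^ (-(γ * r))) ^ (1 / r), by positivity, fun d => ?_⟩
    rw [if_neg h.ne', Real.rpow_zero, mul_one, min_eq_right h.le,
      ← Real.mul_rpow (by positivity) (by positivity), mul_comm]
    have := hS d
    gcongr
    exact sum_range_succ_rpow_neg_le_tsum hp _

/-- The tail integral of `‖z‖^{-n-ε}` in the `ℓ∞` norm. -/
lemma exists_lintegral_tail_le {n : ℕ} (hn : 0 < n) {ε : ℝ} (hε : 0 < ε) :
    ∃ A : ℝ, 0 < A ∧ ∀ (s : ℝ), 0 < s → ∀ y : Fin n → ℝ,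
      ∫⁻ x in {x | s ≤ dist x y}, ENNReal.ofReal (dist x y ^ (-(n : ℝ) - ε)) ≤
        ENNReal.ofReal (A * s ^ (-ε)) := by
  have : Nonempty (Fin n) := ⟨⟨0, hn⟩⟩
  set v : ℝ := volume.real (Metric.ball (0 : Fin n → ℝ) 1)
  refine ⟨n * v / ε + 1, by positivity, fun s hs y => ?_⟩
  set f : ℝ → ℝ := (Set.Ioi s).indicator fun t => t ^ (-(n : ℝ) - ε) with hf
  set g : ℝ → ℝ := (Set.Ici s).indicator fun t => t ^ (-(n : ℝ) - ε) with hg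
  have hfg : g =ᵐ[volume] f := by
    have : Set.Ici s =ᵐ[volume] Set.Ioi s := Ioi_ae_eq_Ici.symm
    exact indicator_ae_eq_of_ae_eq_set this
  have hdim : Module.finrank ℝ (Fin n → ℝ) = n := by simp
  have key : ∀ t : ℝ, t ^ (n - 1) • f t =
      (Set.Ioi s).indicator (fun t => t ^ (-1 - ε)) t := by
    intro t
    by_cases ht : t ∈ Set.Ioi s
    · have ht0 : 0 < t := hs.trans ht
      simp only [hf, Set.indicator_of_mem ht, smul_eq_mul]
      rw [← Real.rpow_natCast, ← Real.rpow_add ht0, Nat.cast_sub hn]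
      congr 1; push_cast; ring
    · simp [hf, Set.indicator_of_notMem ht]
  have hint1 : IntegrableOn (fun t : ℝ => t ^ (n - 1) • f t) (Set.Ioi 0) := by
    simp only [key]
    exact ((integrableOn_Ioi_rpow_of_lt (by linarith) hs).integrable_indicator
      measurableSet_Ioi).integrableOn
  have hgf : (fun t : ℝ => t ^ (n - 1) • g t) =ᵐ[volume.restrict (Set.Ioi 0)]
      fun t : ℝ => t ^ (n - 1) • f t := by
    filter_upwards [ae_restrict_of_ae hfg] with t ht
    rw [ht]
  have hint : Integrable (fun x : Fin n → ℝ => g ‖x‖) := by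
    rw [integrable_fun_norm_addHaar, hdim]
    exact hint1.congr hgf.symm
  have hval : ∫ x : Fin n → ℝ, g ‖x‖ = n * v / ε * s ^ (-ε) := by
    rw [integral_fun_norm_addHaar, hdim, integral_congr_ae hgf]
    simp only [key]
    rw [setIntegral_indicator measurableSet_Ioi, Set.inter_eq_self_of_subset_right
      (Set.Ioi_subset_Ioi hs.le), integral_Ioi_rpow_of_lt (by linarith) hs]
    simp only [nsmul_eq_mul, smul_eq_mul]
    rw [show -1 - ε + 1 = -ε by ring, neg_div_neg_eq]
    ring
  have hg0 : ∀ t, 0 ≤ g t := fun t =>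
    Set.indicator_nonneg (fun t ht => Real.rpow_nonneg (hs.le.trans ht) _) t
  have hmeas : MeasurableSet {x : Fin n → ℝ | s ≤ dist x y} :=
    measurableSet_le measurable_const (by fun_prop)
  calc _ = ∫⁻ x : Fin n → ℝ, ENNReal.ofReal (g ‖x - y‖) := by
        rw [← lintegral_indicator hmeas]
        congr 1 with x
        simp only [hg, Set.indicator, Set.mem_ofPred_eq, dist_eq_norm, Set.mem_Ici]
        split_ifs <;> simp
    _ = ∫⁻ x : Fin n → ℝ, ENNReal.ofReal (g ‖x‖) :=
        lintegral_sub_right_eq_self (fun x => ENNReal.ofReal (g ‖x‖)) y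
    _ = ENNReal.ofReal (n * v / ε * s ^ (-ε)) := by
        rw [← hval, ofReal_integral_eq_lintegral_ofReal hint (ae_of_all _ fun x => hg0 _)]
    _ ≤ _ := by
        apply ENNReal.ofReal_le_ofReal
        gcongr
        linarith

lemma sideLen_pos (k : ℤ) : 0 < sideLen k := zpow_pos two_pos _

lemma sideLen_add (k : ℤ) (d : ℕ) : sideLen (k + d) = sideLen k / 2 ^ d := by
  simp only [sideLen, neg_add]
  rw [zpow_add₀ two_ne_zero, zpow_neg _ (d : ℤ), zpow_natCast, div_eq_mul_inv]

lemma dyadicCube_eq_pi (n : ℕ) (k : ℤ) (q : Fin n → ℤ) :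
    dyadicCube n k q =
      Set.univ.pi fun i => Set.Ico (sideLen k * q i) (sideLen k * (q i + 1)) := by
  ext x; simp [dyadicCube, sideLen, Set.mem_pi]

lemma measurableSet_dyadicCube (n : ℕ) (k : ℤ) (q : Fin n → ℤ) :
    MeasurableSet (dyadicCube n k q) := by
  rw [dyadicCube_eq_pi]
  exact MeasurableSet.univ_pi fun i => measurableSet_Ico

lemma volume_dyadicCube (n : ℕ) (k : ℤ) (q : Fin n → ℤ) :
    volume (dyadicCube n k q) = ENNReal.ofReal (sideLen k ^ n) := by
  rw [dyadicCube_eq_pi, Real.volume_pi_Ico]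
  simp only [mul_add, mul_one, add_sub_cancel_left]
  rw [← ENNReal.ofReal_prod_of_nonneg fun i _ => (sideLen_pos k).le]
  simp

lemma abs_haar1D (k m : ℤ) (η : Bool) (t : ℝ) :
    |haar1D k m η t| = (Set.Ico (sideLen k * m) (sideLen k * (m + 1))).indicator
      (fun _ => (Real.sqrt (sideLen k))⁻¹) t := by
  have hs := sideLen_pos k
  unfold sideLen at hs
  unfold haar1D sideLen
  rw [abs_mul, abs_of_nonneg (by positivity)]
  have h1 : (2 : ℝ) ^ (-k) * (m + 1 / 2) = 2 ^ (-k) * m + 2 ^ (-k) / 2 := by ring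
  have h2 : (2 : ℝ) ^ (-k) * (m + 1) = 2 ^ (-k) * m + 2 ^ (-k) := by ring
  rw [h1, h2]
  cases η
  · simp only [Set.indicator, Bool.false_eq_true, if_false]
    split_ifs <;> simp
  · simp only [Set.indicator, if_true, Set.mem_Ico]
    split_ifs <;> simp <;> grind

lemma abs_haarFn (n : ℕ) (k : ℤ) (q : Fin n → ℤ) (η : Fin n → Bool) (x : Fin n → ℝ) :
    |haarFn n k q η x| =
      (dyadicCube n k q).indicator (fun _ => sideLen k ^ (-(n : ℝ) / 2)) x := by
  have hs := sideLen_pos k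
  unfold haarFn
  rw [Finset.abs_prod]
  simp only [abs_haar1D]
  by_cases hx : x ∈ dyadicCube n k q
  · rw [Set.indicator_of_mem hx]
    rw [dyadicCube_eq_pi, Set.mem_univ_pi] at hx
    rw [Finset.prod_congr rfl fun i _ => Set.indicator_of_mem (hx i) _, Finset.prod_const,
      Finset.card_univ, Fintype.card_fin, Real.sqrt_eq_rpow, ← Real.rpow_neg hs.le,
      ← Real.rpow_natCast, ← Real.rpow_mul hs.le]
    congr 1; ring
  · rw [Set.indicator_of_notMem hx]
    rw [dyadicCube_eq_pi, Set.mem_univ_pi] at hx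
    push Not at hx
    obtain ⟨i, hi⟩ := hx
    exact Finset.prod_eq_zero (Finset.mem_univ i) (Set.indicator_of_notMem hi _)

lemma integrable_haar1D (k m : ℤ) (η : Bool) : Integrable (haar1D k m η) := by
  unfold haar1D
  have h : ∀ a b : ℝ, Integrable ((Set.Ico a b).indicator (1 : ℝ → ℝ)) := fun a b => by
    rw [integrable_indicator_iff measurableSet_Ico]
    exact integrableOn_const (by simp)
  cases η
  · simpa using (h _ _).const_mul _
  · simpa using ((h _ _).sub (h _ _)).const_mul _

lemma integral_haar1D_true (k m : ℤ) : ∫ t, haar1D k m true t = 0 := by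
  have h : ∀ a b : ℝ, Integrable ((Set.Ico a b).indicator (1 : ℝ → ℝ)) := fun a b => by
    rw [integrable_indicator_iff measurableSet_Ico]
    exact integrableOn_const (by simp)
  simp only [haar1D, if_true]
  rw [integral_const_mul, integral_sub (h _ _) (h _ _), integral_indicator_one measurableSet_Ico,
    integral_indicator_one measurableSet_Ico]
  simp only [Real.volume_real_Ico]
  ring_nf

lemma integrable_haarFn (n : ℕ) (k : ℤ) (q : Fin n → ℤ) (η : Fin n → Bool) :
    Integrable (haarFn n k q η) :=
  Integrable.fintype_prod fun i => integrable_haar1D k (q i) (η i)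

lemma integral_haarFn (n : ℕ) (k : ℤ) (q : Fin n → ℤ) (η : Fin n → Bool)
    (hη : η ≠ fun _ => false) : ∫ x, haarFn n k q η x = 0 := by
  obtain ⟨i, hi⟩ := Function.ne_iff.1 hη
  unfold haarFn
  rw [integral_fintype_prod_volume_eq_prod (f := fun i t => haar1D k (q i) (η i) t)]
  refine Finset.prod_eq_zero (Finset.mem_univ i) ?_
  rw [Bool.eq_true_of_not_eq_false hi, integral_haar1D_true]

lemma dist_cubeCenter_le {n : ℕ} {k : ℤ} {q : Fin n → ℤ} {y : Fin n → ℝ}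
    (hy : y ∈ dyadicCube n k q) : ‖y - cubeCenter n k q‖ ≤ sideLen k / 2 := by
  have hs := sideLen_pos k
  rw [pi_norm_le_iff_of_nonneg (by positivity)]
  intro i
  have h := hy i
  simp only [cubeCenter, Pi.sub_apply, Real.norm_eq_abs, abs_le]
  unfold sideLen
  constructor <;> linarith [h.1, h.2]

/-- Away from `I`, `|T h_I|` is controlled by the average over `I` of the kernel
`ℓ(I)^ε |x - y|^{-n-ε}`: cancellation is used far from `I` and the size of `K` close to `I`. -/
lemma enorm_czIntegral_haarFn_le {n : ℕ} {γ : ℝ} {K : (Fin n → ℝ) → (Fin n → ℝ) → ℝ}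
    (hK : IsNormalisedKernel n γ K) {ε : ℝ} (hε : 0 < ε) (hεγ : ε ≤ γ) (hγ1 : γ ≤ 1)
    (k : ℤ) (q : Fin n → ℤ) {η : Fin n → Bool} (hη : η ≠ fun _ => false)
    {x : Fin n → ℝ} (hx : x ∉ dyadicCube n k q) :
    ‖czIntegral K (haarFn n k q η) x‖ₑ ≤
      ENNReal.ofReal (2 ^ (n + 1) * sideLen k ^ (-(n : ℝ) / 2) * sideLen k ^ ε) *
        ∫⁻ y in dyadicCube n k q, ENNReal.ofReal (dist x y ^ (-(n : ℝ) - ε)) := by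
  have hs := sideLen_pos k
  set δ := sideLen k
  set c := cubeCenter n k q
  have hγ0 : 0 < γ := hε.trans_le hεγ
  have step : ∀ G : (Fin n → ℝ) → ℝ,
      (∀ y ∈ dyadicCube n k q, |G y| ≤ 2 ^ (n + 1) * δ ^ ε * dist x y ^ (-(n : ℝ) - ε)) →
      ‖∫ y, G y * haarFn n k q η y‖ₑ ≤
        ENNReal.ofReal (2 ^ (n + 1) * δ ^ (-(n : ℝ) / 2) * δ ^ ε) *
        ∫⁻ y in dyadicCube n k q, ENNReal.ofReal (dist x y ^ (-(n : ℝ) - ε)) := by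
    intro G hG
    refine (enorm_integral_le_lintegral_enorm _).trans ?_
    rw [← lintegral_const_mul _ (by fun_prop),
      ← lintegral_indicator (measurableSet_dyadicCube n k q)]
    refine lintegral_mono fun y => ?_
    rw [enorm_mul, ← enorm_norm (haarFn n k q η y), Real.norm_eq_abs, abs_haarFn]
    by_cases hy : y ∈ dyadicCube n k q
    · rw [Set.indicator_of_mem hy, Set.indicator_of_mem hy, Real.enorm_eq_ofReal_abs,
        Real.enorm_eq_ofReal (by positivity), ← ENNReal.ofReal_mul (by positivity),
        ← ENNReal.ofReal_mul (by positivity)]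
      apply ENNReal.ofReal_le_ofReal
      calc _ ≤ (2 ^ (n + 1) * δ ^ ε * dist x y ^ (-(n : ℝ) - ε)) * δ ^ (-(n : ℝ) / 2) := by
            gcongr
            exact hG y hy
        _ = _ := by ring
    · rw [Set.indicator_of_notMem hy, Set.indicator_of_notMem hy]
      simp
  by_cases hxc : dist x c ≤ δ
  · refine step (K x) fun y hy => ?_
    have hxy : x ≠ y := fun h => hx (h ▸ hy)
    have hd : 0 < dist x y := dist_pos.2 hxy
    have hyc := dist_cubeCenter_le hy
    rw [← dist_eq_norm] at hyc
    have h2 : dist x y ≤ 2 * δ := by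
      linarith [dist_triangle_right x y c]
    refine (hK.size x y hxy).trans ?_
    have h3 : dist x y ^ (-(n : ℝ)) = dist x y ^ ε * dist x y ^ (-(n : ℝ) - ε) := by
      rw [← Real.rpow_add hd]; ring_nf
    rw [h3]
    gcongr
    calc dist x y ^ ε ≤ (2 * δ) ^ ε := by gcongr
      _ = 2 ^ ε * δ ^ ε := Real.mul_rpow two_pos.le hs.le
      _ ≤ 2 ^ (n + 1) * δ ^ ε := by
        gcongr
        rw [← Real.rpow_natCast]
        apply Real.rpow_le_rpow_of_exponent_le one_le_two
        push_cast
        linarith [Nat.cast_nonneg (α := ℝ) n]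
  · push Not at hxc
    by_cases hint : Integrable fun y => K x y * haarFn n k q η y
    · have heq : czIntegral K (haarFn n k q η) x =
          ∫ y, (K x y - K x c) * haarFn n k q η y := by
        simp only [sub_mul]
        rw [integral_sub hint ((integrable_haarFn n k q η).const_mul _), integral_const_mul,
          integral_haarFn n k q η hη, mul_zero, sub_zero, czIntegral]
      rw [heq]
      refine step (fun y => K x y - K x c) fun y hy => ?_
      have hxy : x ≠ y := fun h => hx (h ▸ hy)
      have hd : 0 < dist x y := dist_pos.2 hxy
      have hyc := dist_cubeCenter_le hy
      have hD : 0 < dist x c := hs.trans hxc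
      have h1 := hK.smooth x c (y - c) (by linarith)
      rw [add_sub_cancel] at h1
      have h2 : dist x y ≤ 2 * dist x c := by
        rw [← dist_eq_norm] at hyc
        linarith [dist_triangle_right x y c]
      calc |K x y - K x c| ≤ ‖y - c‖ ^ γ * dist x c ^ (-(n : ℝ) - γ) := by
            linarith [abs_nonneg (K (x + (y - c)) c - K x c)]
        _ ≤ δ ^ γ * dist x c ^ (-(n : ℝ) - γ) := by
            gcongr
            linarith
        _ = δ ^ ε * δ ^ (γ - ε) * dist x c ^ (-(n : ℝ) - γ) := by
            rw [← Real.rpow_add hs]; ring_nf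
        _ ≤ δ ^ ε * dist x c ^ (γ - ε) * dist x c ^ (-(n : ℝ) - γ) := by
            gcongr
        _ = δ ^ ε * dist x c ^ (-(n : ℝ) - ε) := by
            rw [mul_assoc, ← Real.rpow_add hD]; ring_nf
        _ = δ ^ ε * (2 ^ ((n : ℝ) + ε) * (2 * dist x c) ^ (-(n : ℝ) - ε)) := by
            rw [Real.mul_rpow two_pos.le hD.le, ← mul_assoc ((2 : ℝ) ^ _),
              ← Real.rpow_add two_pos, show (n : ℝ) + ε + (-n - ε) = 0 by ring, Real.rpow_zero,
              one_mul]
        _ ≤ δ ^ ε * (2 ^ (n + 1) * dist x y ^ (-(n : ℝ) - ε)) := by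
            gcongr ?_ * (?_ * ?_)
            · rw [← Real.rpow_natCast]
              apply Real.rpow_le_rpow_of_exponent_le one_le_two
              push_cast
              linarith
            · exact Real.rpow_le_rpow_of_nonpos hd h2
                (by linarith [Nat.cast_nonneg (α := ℝ) n])
        _ = _ := by ring
    · rw [czIntegral, integral_undef hint]
      simp

lemma ofReal_abs_pairing_mul_le {n : ℕ} {γ : ℝ} {K : (Fin n → ℝ) → (Fin n → ℝ) → ℝ}
    (hK : IsNormalisedKernel n γ K) {ε : ℝ} (hε : 0 < ε) (hεγ : ε ≤ γ) (hγ1 : γ ≤ 1)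
    {k k' : ℤ} {q q' : Fin n → ℤ} {η : Fin n → Bool} (hη : η ≠ fun _ => false)
    (hdisj : ∀ x ∈ dyadicCube n k' q', x ∉ dyadicCube n k q) :
    ENNReal.ofReal (|pairing (haarZero n k' q') (czIntegral K (haarFn n k q η))| *
        sideLen k ^ (-(n : ℝ) / 2)) ≤
      ENNReal.ofReal (2 ^ (n + 1) * sideLen k' ^ (-(n : ℝ) / 2) * sideLen k ^ (ε - n)) *
        ∫⁻ y in dyadicCube n k q, ∫⁻ x in dyadicCube n k' q',
          ENNReal.ofReal (dist x y ^ (-(n : ℝ) - ε)) := by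
  have hs := sideLen_pos k
  have hs' := sideLen_pos k'
  have h1 : ‖pairing (haarZero n k' q') (czIntegral K (haarFn n k q η))‖ₑ ≤
      ENNReal.ofReal (sideLen k' ^ (-(n : ℝ) / 2)) *
      (ENNReal.ofReal (2 ^ (n + 1) * sideLen k ^ (-(n : ℝ) / 2) * sideLen k ^ ε) *
        ∫⁻ y in dyadicCube n k q, ∫⁻ x in dyadicCube n k' q',
          ENNReal.ofReal (dist x y ^ (-(n : ℝ) - ε))) := by
    rw [lintegral_lintegral_swap (by fun_prop), ← lintegral_const_mul' _ _ ENNReal.ofReal_ne_top,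
      ← lintegral_const_mul' _ _ ENNReal.ofReal_ne_top,
      ← lintegral_indicator (measurableSet_dyadicCube n k' q')]
    refine (enorm_integral_le_lintegral_enorm _).trans (lintegral_mono fun x => ?_)
    rw [enorm_mul, ← enorm_norm (haarZero n k' q' x), Real.norm_eq_abs, haarZero, abs_haarFn]
    by_cases hx : x ∈ dyadicCube n k' q'
    · rw [Set.indicator_of_mem hx, Set.indicator_of_mem hx, Real.enorm_eq_ofReal (by positivity)]
      gcongr
      exact enorm_czIntegral_haarFn_le hK hε hεγ hγ1 k q hη (hdisj x hx)
    · rw [Set.indicator_of_notMem hx]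
      simp
  rw [ENNReal.ofReal_mul (abs_nonneg _), ← Real.enorm_eq_ofReal_abs, mul_comm]
  refine (mul_le_mul_right h1 _).trans_eq ?_
  rw [← mul_assoc, ← mul_assoc, ← ENNReal.ofReal_mul (by positivity),
    ← ENNReal.ofReal_mul (by positivity)]
  congr 2
  have : sideLen k ^ (ε - n) =
      sideLen k ^ (-(n : ℝ) / 2) * sideLen k ^ (-(n : ℝ) / 2) * sideLen k ^ ε := by
    rw [← Real.rpow_add hs, ← Real.rpow_add hs]; ring_nf
  rw [this]; ring

lemma lintegral_abs_rpow_neg_le {ε : ℝ} (hε1 : ε < 1) {δ : ℝ} (hδ : 0 < δ) :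
    ∫⁻ u in {u : ℝ | |u| ≤ δ}, ENNReal.ofReal (|u| ^ (-ε)) ≤
      ENNReal.ofReal (2 / (1 - ε) * δ ^ (1 - ε)) := by
  set f : ℝ → ℝ := (Set.Iic δ).indicator fun t => t ^ (-ε) with hf
  have hint1 : IntegrableOn f (Set.Ioi 0) := by
    rw [hf, IntegrableOn, integrable_indicator_iff measurableSet_Iic, IntegrableOn,
      Measure.restrict_restrict measurableSet_Iic, Set.inter_comm, Set.Ioi_inter_Iic]
    exact (intervalIntegrable_iff_integrableOn_Ioc_of_le hδ.le).1
      (intervalIntegral.intervalIntegrable_rpow' (by linarith))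
  have hint : Integrable (fun x : ℝ => f ‖x‖) := by
    rw [integrable_fun_norm_addHaar]
    simpa using hint1
  have hval : ∫ x : ℝ, f ‖x‖ = 2 / (1 - ε) * δ ^ (1 - ε) := by
    rw [integral_fun_norm_addHaar]
    simp only [Module.finrank_self, Nat.sub_self, pow_zero, one_smul]
    rw [setIntegral_indicator measurableSet_Iic, Set.Ioi_inter_Iic,
      ← intervalIntegral.integral_of_le hδ.le, integral_rpow (Or.inl (by linarith)),
      Real.volume_real_ball zero_le_one, show -ε + 1 = 1 - ε by ring,
      Real.zero_rpow (by linarith)]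
    simp only [smul_eq_mul]
    ring
  have hf0 : ∀ x : ℝ, 0 ≤ f ‖x‖ := fun x =>
    Set.indicator_apply_nonneg fun _ => Real.rpow_nonneg (norm_nonneg _) _
  rw [← hval, ofReal_integral_eq_lintegral_ofReal hint (ae_of_all _ hf0),
    ← lintegral_indicator (measurableSet_le (by fun_prop) measurable_const)]
  refine lintegral_mono fun x => ?_
  simp only [hf, Set.indicator, Set.mem_ofPred_eq, Set.mem_Iic, Real.norm_eq_abs]
  split_ifs <;> simp

lemma lintegral_dyadicCube_comp_eval {n : ℕ} (k : ℤ) (q : Fin n → ℤ) (i : Fin n)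
    {g : ℝ → ENNReal} (hg : Measurable g) :
    ∫⁻ y in dyadicCube n k q, g (y i) =
      ENNReal.ofReal (sideLen k ^ (n - 1)) *
        ∫⁻ t in Set.Ico (sideLen k * q i) (sideLen k * (q i + 1)), g t := by
  have h := (lintegral_map (μ := volume.restrict (dyadicCube n k q)) (g := fun y => y i) hg
    (measurable_pi_apply i)).symm
  refine h.trans ?_
  rw [dyadicCube_eq_pi, volume_pi, Measure.restrict_pi_pi]
  have h2 := Measure.pi_map_eval (fun j : Fin n => (volume : Measure ℝ).restrict
    (Set.Ico (sideLen k * q j) (sideLen k * (q j + 1)))) i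
  rw [show (fun y : Fin n → ℝ => y i) = Function.eval i from rfl, h2, lintegral_smul_measure,
    smul_eq_mul]
  congr 1
  simp only [Measure.restrict_apply_univ, Real.volume_Ico, mul_add, mul_one, add_sub_cancel_left]
  rw [Finset.prod_const, Finset.card_erase_of_mem (Finset.mem_univ i), Finset.card_univ,
    Fintype.card_fin, ENNReal.ofReal_pow (sideLen_pos k).le]

/-- The integral over a cube of a negative power of the distance to a nearby hyperplane. -/
lemma lintegral_dyadicCube_abs_sub_rpow_le {n : ℕ} (k : ℤ) (q : Fin n → ℤ) (i : Fin n) (f : ℝ)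
    (hf : ∀ t ∈ Set.Ico (sideLen k * q i) (sideLen k * (q i + 1)), |t - f| ≤ sideLen k)
    {ε : ℝ} (hε1 : ε < 1) :
    ∫⁻ y in dyadicCube n k q, ENNReal.ofReal (|y i - f| ^ (-ε)) ≤
      ENNReal.ofReal (2 / (1 - ε) * sideLen k ^ (n - ε)) := by
  have hs := sideLen_pos k
  have hn : 0 < n := i.pos
  rw [lintegral_dyadicCube_comp_eval k q i (g := fun t => ENNReal.ofReal (|t - f| ^ (-ε)))
    (by fun_prop)]
  have h1 : ∫⁻ t in Set.Ico (sideLen k * q i) (sideLen k * (q i + 1)),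
      ENNReal.ofReal (|t - f| ^ (-ε)) ≤ ENNReal.ofReal (2 / (1 - ε) * sideLen k ^ (1 - ε)) := by
    refine le_trans ?_ (lintegral_abs_rpow_neg_le hε1 hs)
    rw [← lintegral_indicator measurableSet_Ico,
      ← lintegral_indicator (measurableSet_le (by fun_prop) measurable_const),
      ← lintegral_sub_right_eq_self
        ({u : ℝ | |u| ≤ sideLen k}.indicator fun u => ENNReal.ofReal (|u| ^ (-ε))) f]
    refine lintegral_mono fun t => ?_
    by_cases ht : t ∈ Set.Ico (sideLen k * q i) (sideLen k * (q i + 1))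
    · rw [Set.indicator_of_mem ht, Set.indicator_of_mem (Set.mem_ofPred_eq ▸ hf t ht)]
    · rw [Set.indicator_of_notMem ht]
      exact zero_le
  refine (mul_le_mul_right h1 _).trans_eq ?_
  rw [← ENNReal.ofReal_mul (by positivity)]
  congr 1
  have : sideLen k ^ ((n : ℝ) - ε) = sideLen k ^ (n - 1) * sideLen k ^ (1 - ε) := by
    rw [← Real.rpow_natCast, ← Real.rpow_add hs, Nat.cast_sub hn]
    congr 1; push_cast; ring
  rw [this]; ring

/-- The coefficient bound for well separated cubes. -/
lemma abs_pairing_mul_le_of_le_dist {n : ℕ} {γ : ℝ} {K : (Fin n → ℝ) → (Fin n → ℝ) → ℝ}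
    (hK : IsNormalisedKernel n γ K) (hγ0 : 0 < γ) (hγ1 : γ ≤ 1)
    {k k' : ℤ} {q q' : Fin n → ℤ} {η : Fin n → Bool} (hη : η ≠ fun _ => false)
    (hdisj : ∀ x ∈ dyadicCube n k' q', x ∉ dyadicCube n k q) {D : ℝ} (hD : 0 < D)
    (hdist : ∀ x ∈ dyadicCube n k' q', ∀ y ∈ dyadicCube n k q, D ≤ dist x y) :
    |pairing (haarZero n k' q') (czIntegral K (haarFn n k q η))| * sideLen k ^ (-(n : ℝ) / 2) ≤
      2 ^ (n + 1) * sideLen k ^ γ * sideLen k' ^ ((n : ℝ) / 2) * D ^ (-(n : ℝ) - γ) := by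
  have hs := sideLen_pos k
  have hs' := sideLen_pos k'
  rw [← ENNReal.ofReal_le_ofReal_iff (by positivity)]
  refine (ofReal_abs_pairing_mul_le hK hγ0 le_rfl hγ1 hη hdisj).trans ?_
  have h1 : ∫⁻ y in dyadicCube n k q, ∫⁻ x in dyadicCube n k' q',
      ENNReal.ofReal (dist x y ^ (-(n : ℝ) - γ)) ≤
      ∫⁻ y in dyadicCube n k q, ∫⁻ x in dyadicCube n k' q',
        ENNReal.ofReal (D ^ (-(n : ℝ) - γ)) := by
    refine setLIntegral_mono' (measurableSet_dyadicCube _ _ _) fun y hy =>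
      setLIntegral_mono' (measurableSet_dyadicCube _ _ _) fun x hx => ?_
    exact ENNReal.ofReal_le_ofReal (Real.rpow_le_rpow_of_nonpos hD (hdist x hx y hy)
      (by linarith [Nat.cast_nonneg (α := ℝ) n]))
  refine (mul_le_mul_right h1 _).trans_eq ?_
  simp only [lintegral_const, Measure.restrict_apply_univ, volume_dyadicCube]
  rw [← ENNReal.ofReal_mul (by positivity), ← ENNReal.ofReal_mul (by positivity),
    ← ENNReal.ofReal_mul (by positivity)]
  congr 1
  have e1 : sideLen k ^ γ = sideLen k ^ (γ - n) * sideLen k ^ n := by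
    rw [← Real.rpow_natCast, ← Real.rpow_add hs]; ring_nf
  have e2 : sideLen k' ^ ((n : ℝ) / 2) = sideLen k' ^ (-(n : ℝ) / 2) * sideLen k' ^ n := by
    rw [← Real.rpow_natCast, ← Real.rpow_add hs']; ring_nf
  rw [e1, e2]; ring

/-- The coefficient bound for cubes separated by a hyperplane `{y i = f}`, in terms of the
constant `A` in the tail estimate. -/
lemma abs_pairing_mul_le_of_hyperplane {n : ℕ} {γ : ℝ} {K : (Fin n → ℝ) → (Fin n → ℝ) → ℝ}
    (hK : IsNormalisedKernel n γ K) {ε : ℝ} (hε : 0 < ε) (hεγ : ε ≤ γ) (hγ1 : γ ≤ 1)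
    {k k' : ℤ} {q q' : Fin n → ℤ} {η : Fin n → Bool} (hη : η ≠ fun _ => false)
    (hdisj : ∀ x ∈ dyadicCube n k' q', x ∉ dyadicCube n k q) {A B f : ℝ} (hA : 0 ≤ A)
    (hB : 0 ≤ B) {i : Fin n}
    (htail : ∀ s : ℝ, 0 < s → ∀ y : Fin n → ℝ,
      ∫⁻ x in {x | s ≤ dist x y}, ENNReal.ofReal (dist x y ^ (-(n : ℝ) - ε)) ≤
        ENNReal.ofReal (A * s ^ (-ε)))
    (hdist : ∀ x ∈ dyadicCube n k' q', ∀ y ∈ dyadicCube n k q, |y i - f| ≤ dist x y)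
    (hint : ∫⁻ y in dyadicCube n k q, ENNReal.ofReal (|y i - f| ^ (-ε)) ≤
      ENNReal.ofReal (B * sideLen k ^ (n - ε))) :
    |pairing (haarZero n k' q') (czIntegral K (haarFn n k q η))| * sideLen k ^ (-(n : ℝ) / 2) ≤
      2 ^ (n + 1) * A * B * sideLen k' ^ (-(n : ℝ) / 2) := by
  have hs := sideLen_pos k
  have hs' := sideLen_pos k'
  rw [← ENNReal.ofReal_le_ofReal_iff (by positivity)]
  refine (ofReal_abs_pairing_mul_le hK hε hεγ hγ1 hη hdisj).trans ?_
  have hne : ∀ᵐ y : Fin n → ℝ ∂volume, y i ≠ f := by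
    have h := Measure.pi_hyperplane (fun _ : Fin n => (volume : Measure ℝ)) i f
    rw [← volume_pi] at h
    exact compl_mem_ae_iff.2 h
  have h1 : ∫⁻ y in dyadicCube n k q, ∫⁻ x in dyadicCube n k' q',
      ENNReal.ofReal (dist x y ^ (-(n : ℝ) - ε)) ≤
      ENNReal.ofReal A * ENNReal.ofReal (B * sideLen k ^ (n - ε)) := by
    calc _ ≤ ∫⁻ y in dyadicCube n k q, ENNReal.ofReal A * ENNReal.ofReal (|y i - f| ^ (-ε)) := by
          refine setLIntegral_mono_ae' (measurableSet_dyadicCube _ _ _) ?_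
          filter_upwards [hne] with y hyne hy
          rw [← ENNReal.ofReal_mul hA]
          refine le_trans (lintegral_mono_set fun x hx => hdist x hx y hy) (htail _ ?_ y)
          exact abs_pos.2 (sub_ne_zero.2 hyne)
      _ ≤ _ := by
          rw [lintegral_const_mul' _ _ ENNReal.ofReal_ne_top]
          gcongr
  refine (mul_le_mul_right h1 _).trans_eq ?_
  rw [← ENNReal.ofReal_mul hA, ← ENNReal.ofReal_mul (by positivity)]
  congr 1
  have : sideLen k ^ (ε - n) * sideLen k ^ (n - ε) = 1 := by
    rw [← Real.rpow_add hs]; simp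
  linear_combination (2 ^ (n + 1) * A * B * sideLen k' ^ (-(n : ℝ) / 2)) * this

lemma eq_of_mem_dyadicCube {n : ℕ} {k : ℤ} {q q' : Fin n → ℤ} {x : Fin n → ℝ}
    (h : x ∈ dyadicCube n k q) (h' : x ∈ dyadicCube n k q') : q = q' := by
  funext i
  have hs : (0 : ℝ) < 2 ^ (-k) := sideLen_pos k
  have h1 : (q i : ℝ) < q' i + 1 := lt_of_mul_lt_mul_left ((h i).1.trans_lt (h' i).2) hs.le
  have h2 : (q' i : ℝ) < q i + 1 := lt_of_mul_lt_mul_left ((h' i).1.trans_lt (h i).2) hs.le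
  have h3 : q i < q' i + 1 := by exact_mod_cast h1
  have h4 : q' i < q i + 1 := by exact_mod_cast h2
  omega

lemma average_haar_sum_le {n d : ℕ} {r : ℝ} (hr : 1 ≤ r) (kJ : ℤ) (mJ : Fin n → ℤ)
    (η : Fin n → Bool) (c : (Fin n → Fin (2 ^ d)) → ℝ) :
    (volume (dyadicCube n kJ mJ))⁻¹ * ∫⁻ x in dyadicCube n kJ mJ, ENNReal.ofReal
        (|∑ a, c a * haarFn n (kJ + d) (fun i => 2 ^ d * mJ i + (a i : ℤ)) η x| ^ r) ≤
      ENNReal.ofReal (((2 ^ d : ℝ) ^ n)⁻¹ *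
        ∑ a, (|c a| * sideLen (kJ + d) ^ (-(n : ℝ) / 2)) ^ r) := by
  have hs := sideLen_pos kJ
  have hs' := sideLen_pos (kJ + d)
  set Q : (Fin n → Fin (2 ^ d)) → Set (Fin n → ℝ) :=
    fun a => dyadicCube n (kJ + d) (fun i => 2 ^ d * mJ i + (a i : ℤ))
  have hinj : ∀ a b x, x ∈ Q a → x ∈ Q b → a = b := fun a b x ha hb => by
    have h := eq_of_mem_dyadicCube ha hb
    funext i
    have := congrFun h i
    simp only [add_right_inj, Nat.cast_inj] at this
    exact Fin.ext this
  have hpt : ∀ x, ENNReal.ofReal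
      (|∑ a, c a * haarFn n (kJ + d) (fun i => 2 ^ d * mJ i + (a i : ℤ)) η x| ^ r) ≤
      ∑ a, (Q a).indicator (fun _ =>
        ENNReal.ofReal ((|c a| * sideLen (kJ + d) ^ (-(n : ℝ) / 2)) ^ r)) x := by
    intro x
    by_cases hx : ∃ a, x ∈ Q a
    · obtain ⟨a, ha⟩ := hx
      rw [Finset.sum_eq_single a _ (by simp)]
      · refine le_trans ?_ (Finset.single_le_sum (fun _ _ => zero_le) (Finset.mem_univ a))
        rw [Set.indicator_of_mem ha, abs_mul, abs_haarFn, Set.indicator_of_mem ha]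
      · intro b _ hb
        have hxb : x ∉ Q b := fun h => hb (hinj b a x h ha)
        have := abs_haarFn n (kJ + d) (fun i => 2 ^ d * mJ i + (b i : ℤ)) η x
        rw [Set.indicator_of_notMem hxb, abs_eq_zero] at this
        rw [this, mul_zero]
    · push Not at hx
      rw [Finset.sum_eq_zero]
      · rw [abs_zero, Real.zero_rpow (by linarith)]
        simp
      · intro b _
        have := abs_haarFn n (kJ + d) (fun i => 2 ^ d * mJ i + (b i : ℤ)) η x
        rw [Set.indicator_of_notMem (hx b), abs_eq_zero] at this
        rw [this, mul_zero]
  calc _ ≤ (volume (dyadicCube n kJ mJ))⁻¹ * ∫⁻ x, ∑ a, (Q a).indicator (fun _ =>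
        ENNReal.ofReal ((|c a| * sideLen (kJ + d) ^ (-(n : ℝ) / 2)) ^ r)) x := by
        exact mul_le_mul_right
          ((setLIntegral_le_lintegral _ _).trans (lintegral_mono hpt)) _
    _ = _ := by
        rw [lintegral_finsetSum _ fun a _ =>
          measurable_const.indicator (measurableSet_dyadicCube _ _ _)]
        simp only [lintegral_indicator_const (measurableSet_dyadicCube _ _ _),
          volume_dyadicCube]
        rw [← Finset.sum_mul, ← ENNReal.ofReal_sum_of_nonneg fun a _ => by positivity,
          ← ENNReal.ofReal_inv_of_pos (by positivity),
          ← ENNReal.ofReal_mul (Finset.sum_nonneg fun a _ => by positivity),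
          ← ENNReal.ofReal_mul (by positivity), sideLen_add]
        congr 1
        rw [div_pow, ← mul_assoc, mul_comm, ← mul_assoc]
        congr 1
        field_simp

lemma average_pi_sum {n N : ℕ} (hN : 0 < N) (i : Fin n) (τ : Fin N ≃ Fin N) (F : ℕ → ℝ) :
    ((N : ℝ) ^ n)⁻¹ * ∑ a : Fin n → Fin N, F (τ (a i)) =
      (N : ℝ)⁻¹ * ∑ j ∈ Finset.range N, F j := by
  have h := Fintype.sum_piFinset_apply (fun j : Fin N => F (τ j)) Finset.univ i
  rw [Fintype.piFinset_univ, Equiv.sum_comp τ (fun j : Fin N => F j), Fin.sum_univ_eq_sum_range,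
    Finset.card_univ, Fintype.card_fin, Fintype.card_fin] at h
  rw [h, nsmul_eq_mul]
  have hn : n = n - 1 + 1 := by have := i.pos; omega
  have hN' : (0 : ℝ) < N := by exact_mod_cast hN
  rw [show (N : ℝ) ^ n = N ^ (n - 1) * N by rw [← pow_succ, ← hn]]
  push_cast
  field_simp

lemma mem_subcube {n d : ℕ} {kJ : ℤ} {mJ : Fin n → ℤ} {a : Fin n → Fin (2 ^ d)}
    {y : Fin n → ℝ} (hy : y ∈ dyadicCube n (kJ + d) (fun i => 2 ^ d * mJ i + (a i : ℤ)))
    (i : Fin n) :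
    sideLen kJ * mJ i + sideLen (kJ + d) * (a i : ℕ) ≤ y i ∧
      y i < sideLen kJ * mJ i + sideLen (kJ + d) * ((a i : ℕ) + 1) := by
  have h := hy i
  rw [show (2 : ℝ) ^ (-(kJ + d)) = sideLen (kJ + d) from rfl] at h
  have e : sideLen kJ = sideLen (kJ + d) * 2 ^ d := by
    rw [sideLen_add]; field_simp
  push_cast at h
  rw [e]
  constructor <;> linarith [h.1, h.2]

lemma subcube_subset {n d : ℕ} {kJ : ℤ} {mJ : Fin n → ℤ} (a : Fin n → Fin (2 ^ d)) :
    dyadicCube n (kJ + d) (fun i => 2 ^ d * mJ i + (a i : ℤ)) ⊆ dyadicCube n kJ mJ := by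
  intro y hy i
  have h := mem_subcube hy i
  have hs := sideLen_pos (kJ + d)
  have e : sideLen kJ = sideLen (kJ + d) * 2 ^ d := by
    rw [sideLen_add]; field_simp
  have ha : ((a i : ℕ) : ℝ) + 1 ≤ 2 ^ d := by exact_mod_cast (a i).2
  have h1 : sideLen (kJ + d) * ((a i : ℕ) + 1) ≤ sideLen kJ := by
    rw [e]; gcongr
  have h2 : 0 ≤ sideLen (kJ + d) * (a i : ℕ) := by positivity
  change sideLen kJ * _ ≤ _ ∧ _ < sideLen kJ * _
  constructor <;> linarith [h.1, h.2]

lemma le_dist_of_translate {n : ℕ} {kJ : ℤ} {mJ m : Fin n → ℤ} {x y : Fin n → ℝ}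
    (hx : x ∈ dyadicCube n kJ (mJ + m)) (hy : y ∈ dyadicCube n kJ mJ) (i : Fin n) :
    sideLen kJ * (|(m i : ℝ)| - 1) ≤ dist x y := by
  refine le_trans ?_ (dist_le_pi_dist x y i)
  rw [Real.dist_eq]
  have hs := sideLen_pos kJ
  have h1 : sideLen kJ * _ ≤ _ ∧ _ < sideLen kJ * _ := hx i
  have h2 : sideLen kJ * _ ≤ _ ∧ _ < sideLen kJ * _ := hy i
  push_cast [Pi.add_apply] at h1
  rcases abs_cases (m i : ℝ) with ⟨h, -⟩ | ⟨h, -⟩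
  · rw [h]
    refine le_trans ?_ (le_abs_self _)
    linarith
  · rw [h]
    refine le_trans ?_ (neg_le_abs _)
    linarith

/-- If `J∔m` is adjacent to `J` in the direction `i`, they are separated by a hyperplane
`{y i = f}`, and the distance of the subcubes of `J` to it is read off from their position. -/
lemma exists_hyperplane {n : ℕ} (kJ : ℤ) (mJ m : Fin n → ℤ) (d : ℕ) (i : Fin n)
    (hi : |m i| = 1) :
    ∃ (f : ℝ) (τ : Fin (2 ^ d) ≃ Fin (2 ^ d)), ∀ (a : Fin n → Fin (2 ^ d)),
      (∀ y ∈ dyadicCube n (kJ + d) (fun i => 2 ^ d * mJ i + (a i : ℤ)),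
        ∀ x ∈ dyadicCube n kJ (mJ + m), |y i - f| ≤ dist x y) ∧
      ∀ t : ℝ, sideLen kJ * mJ i + sideLen (kJ + d) * (a i : ℕ) ≤ t →
        t < sideLen kJ * mJ i + sideLen (kJ + d) * ((a i : ℕ) + 1) →
        sideLen (kJ + d) * (τ (a i) : ℕ) ≤ |t - f| ∧
        |t - f| ≤ sideLen (kJ + d) * ((τ (a i) : ℕ) + 1) := by
  have hs := sideLen_pos kJ
  have hs' := sideLen_pos (kJ + d)
  have e : sideLen kJ = sideLen (kJ + d) * 2 ^ d := by
    rw [sideLen_add]; field_simp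
  rcases (abs_eq zero_le_one).1 hi with h | h
  · refine ⟨sideLen kJ * (mJ i + 1), Fin.revPerm, fun a => ⟨fun y hy x hx => ?_, fun t ht1 ht2 => ?_⟩⟩
    · refine le_trans ?_ (dist_le_pi_dist x y i)
      have h1 : sideLen kJ * _ ≤ _ ∧ _ < sideLen kJ * _ := hx i
      have h2 : sideLen kJ * _ ≤ _ ∧ _ < sideLen kJ * _ := subcube_subset a hy i
      push_cast [Pi.add_apply, h] at h1
      rw [Real.dist_eq, abs_sub_comm, abs_of_pos (by linarith), abs_of_pos (by linarith)]
      linarith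
    · have ha : ((a i : ℕ) : ℝ) + 1 ≤ 2 ^ d := by exact_mod_cast (a i).2
      have hr : ((Fin.revPerm (a i) : ℕ) : ℝ) = 2 ^ d - (a i + 1) := by
        rw [Fin.revPerm_apply, Fin.val_rev, Nat.cast_sub (a i).2]
        push_cast; ring
      have h1 : sideLen (kJ + d) * ((a i : ℕ) + 1) ≤ sideLen kJ := by
        rw [e]; gcongr
      rw [hr, abs_sub_comm, abs_of_pos (by linarith)]
      constructor <;> linarith
  · refine ⟨sideLen kJ * mJ i, Equiv.refl _, fun a => ⟨fun y hy x hx => ?_, fun t ht1 ht2 => ?_⟩⟩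
    · refine le_trans ?_ (dist_le_pi_dist x y i)
      have h1 : sideLen kJ * _ ≤ _ ∧ _ < sideLen kJ * _ := hx i
      have h2 : sideLen kJ * _ ≤ _ ∧ _ < sideLen kJ * _ := subcube_subset a hy i
      push_cast [Pi.add_apply, h] at h1
      rw [Real.dist_eq, abs_sub_comm (x i), abs_of_nonneg (by linarith),
        abs_of_pos (by linarith)]
      linarith
    · have h0 : 0 ≤ sideLen (kJ + d) * (a i : ℕ) := by positivity
      rw [abs_of_nonneg (by linarith), Equiv.refl_apply]
      constructor <;> linarith

/-- The coefficient bound for adjacent cubes. -/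
lemma exists_abs_pairing_mul_le_adjacent {n : ℕ} (hn : 0 < n) {γ : ℝ} (hγ0 : 0 < γ)
    (hγ1 : γ ≤ 1) :
    ∃ C : ℝ, 0 < C ∧ ∀ K : (Fin n → ℝ) → (Fin n → ℝ) → ℝ, IsNormalisedKernel n γ K →
      ∀ (kJ : ℤ) (mJ : Fin n → ℤ) (d : ℕ) (m : Fin n → ℤ), m ≠ 0 →
      ∀ i : Fin n, |m i| = 1 → ∀ η : Fin n → Bool, η ≠ (fun _ => false) →
      ∃ τ : Fin (2 ^ d) ≃ Fin (2 ^ d), ∀ a : Fin n → Fin (2 ^ d),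
        |pairing (haarZero n kJ (mJ + m))
            (czIntegral K (haarFn n (kJ + d) (fun i => 2 ^ d * mJ i + (a i : ℤ)) η))| *
          sideLen (kJ + d) ^ (-(n : ℝ) / 2) ≤
        C * sideLen kJ ^ (-(n : ℝ) / 2) * (((τ (a i) : ℕ) : ℝ) + 1) ^ (-γ) := by
  obtain ⟨A, hA, htail⟩ := exists_lintegral_tail_le hn hγ0
  obtain ⟨A', hA', htail'⟩ := exists_lintegral_tail_le hn (half_pos hγ0)
  have hγ2 : 0 < 1 - γ / 2 := by linarith
  refine ⟨2 ^ (n + 1) * A * 2 ^ γ + 2 ^ (n + 1) * A' * (2 / (1 - γ / 2)), by positivity,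
    fun K hK kJ mJ d m hm i hi η hη => ?_⟩
  obtain ⟨f, τ, hτ⟩ := exists_hyperplane kJ mJ m d i hi
  refine ⟨τ, fun a => ?_⟩
  obtain ⟨hdist, hpos⟩ := hτ a
  have hs := sideLen_pos kJ
  have hs' := sideLen_pos (kJ + d)
  have hdisj : ∀ x ∈ dyadicCube n kJ (mJ + m),
      x ∉ dyadicCube n (kJ + d) (fun i => 2 ^ d * mJ i + (a i : ℤ)) := fun x hx hx' =>
    hm (by simpa using eq_of_mem_dyadicCube hx (subcube_subset a hx'))
  rcases Nat.eq_zero_or_pos (τ (a i) : ℕ) with h0 | h0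
  · refine (abs_pairing_mul_le_of_hyperplane hK (half_pos hγ0) (by linarith) hγ1 hη hdisj hA'.le
      (B := 2 / (1 - γ / 2)) (by positivity) htail' (fun x hx y hy => hdist y hy x hx)
      (lintegral_dyadicCube_abs_sub_rpow_le _ _ i f (fun t ht => ?_) (by linarith))).trans ?_
    · have e : sideLen kJ = sideLen (kJ + d) * 2 ^ d := by
        rw [sideLen_add]; field_simp
      have ht' := ht
      rw [Set.mem_Ico] at ht'
      push_cast at ht'
      have := (hpos t (by rw [e]; linarith) (by rw [e]; linarith)).2
      rw [h0] at this
      simpa using this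
    · rw [h0]
      simp only [Nat.cast_zero, zero_add, Real.one_rpow, mul_one]
      gcongr
      have : 0 < 2 ^ (n + 1) * A * 2 ^ γ := by positivity
      linarith
  · have h1 : (1 : ℝ) ≤ (τ (a i) : ℕ) := by exact_mod_cast h0
    have htpos : (0 : ℝ) < (τ (a i) : ℕ) := by linarith
    refine (abs_pairing_mul_le_of_hyperplane hK hγ0 le_rfl hγ1 hη hdisj hA.le
      (B := ((τ (a i) : ℕ) : ℝ) ^ (-γ)) (by positivity) htail
      (fun x hx y hy => hdist y hy x hx) ?_).trans ?_
    · calc _ ≤ ∫⁻ y in dyadicCube n (kJ + d) (fun i => 2 ^ d * mJ i + (a i : ℤ)),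
            ENNReal.ofReal ((sideLen (kJ + d) * (τ (a i) : ℕ)) ^ (-γ)) := by
            refine setLIntegral_mono' (measurableSet_dyadicCube _ _ _) fun y hy => ?_
            have := mem_subcube hy i
            exact ENNReal.ofReal_le_ofReal (Real.rpow_le_rpow_of_nonpos (by positivity)
              (hpos _ this.1 this.2).1 (by linarith))
        _ = _ := by
            rw [lintegral_const, Measure.restrict_apply_univ, volume_dyadicCube,
              ← ENNReal.ofReal_mul (by positivity), Real.mul_rpow hs'.le htpos.le,
              sub_eq_neg_add, Real.rpow_add hs', Real.rpow_natCast]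
            congr 1; ring
    · have h2 : ((τ (a i) : ℕ) : ℝ) ^ (-γ) ≤ 2 ^ γ * (((τ (a i) : ℕ) : ℝ) + 1) ^ (-γ) := by
        rw [Real.rpow_neg htpos.le, Real.rpow_neg (by positivity), ← div_eq_mul_inv,
          inv_le_iff_one_le_mul₀ (by positivity), ← mul_div_right_comm,
          ← Real.mul_rpow two_pos.le htpos.le, one_le_div (by positivity)]
        gcongr
        linarith
      calc _ ≤ 2 ^ (n + 1) * A * (2 ^ γ * (((τ (a i) : ℕ) : ℝ) + 1) ^ (-γ)) *
            sideLen kJ ^ (-(n : ℝ) / 2) := by gcongr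
        _ = (2 ^ (n + 1) * A * 2 ^ γ) * sideLen kJ ^ (-(n : ℝ) / 2) *
            (((τ (a i) : ℕ) : ℝ) + 1) ^ (-γ) := by ring
        _ ≤ _ := by
            gcongr
            have : 0 < 2 ^ (n + 1) * A' * (2 / (1 - γ / 2)) := by positivity
            linarith

lemma exists_abs_eq_inorm {n : ℕ} (hn : 0 < n) (m : Fin n → ℤ) :
    ∃ i, |(m i : ℝ)| = inorm m := by
  have : Nonempty (Fin n) := ⟨⟨0, hn⟩⟩
  have h := Finite.exists_max fun i => |(m i : ℝ)|
  obtain ⟨i, hi⟩ := h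
  refine ⟨i, le_antisymm (norm_le_pi_norm (fun i => (m i : ℝ)) i) ?_⟩
  exact (pi_norm_le_iff_of_nonneg (abs_nonneg _)).2 hi

open Classical in
/-- Lemma 4.4: the averaged `L^r` estimate.  Here the cube `J` is indexed by `(kJ, mJ)`,
the smaller cubes `K ⊆ J` with `ℓ(K) = 2^{-d} ℓ(J)` are indexed by `a`, and `J∔m` is the
translate of `J` by `m` times its side length. -/
theorem statement7 (n : ℕ) (hn : 0 < n) (γ r : ℝ) (hγ0 : 0 < γ) (hγ1 : γ ≤ 1) (hr : 1 ≤ r) :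
    ∃ C : ℝ, 0 < C ∧
      ∀ K : (Fin n → ℝ) → (Fin n → ℝ) → ℝ, IsNormalisedKernel n γ K →
      ∀ (kJ : ℤ) (mJ : Fin n → ℤ) (d : ℕ) (m : Fin n → ℤ), m ≠ 0 →
      ∀ η : Fin n → Bool, η ≠ (fun _ => false) →
        ((volume (dyadicCube n kJ mJ))⁻¹ *
            ∫⁻ x in dyadicCube n kJ mJ,
              ENNReal.ofReal
                (|∑ a : Fin n → Fin (2^d),
                    pairing (haarZero n kJ (mJ + m))
                        (czIntegral K
                          (haarFn n (kJ + d) (fun i => 2^d * mJ i + (a i : ℤ)) η)) *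
                      haarFn n (kJ + d) (fun i => 2^d * mJ i + (a i : ℤ)) η x| ^ r)) ^ (1/r) ≤
          ENNReal.ofReal
            (C * sideLen kJ ^ (-(n:ℝ)/2) * ((2:ℝ) ^ (-(d:ℝ))) ^ min γ (1/r) *
              (1 + Real.log ((2:ℝ) ^ (d:ℕ))) ^ (if γ = 1/r then 1/r else 0) *
              (1 + inorm m) ^ (-(n:ℝ) - γ)) := by
  obtain ⟨C₀, hC₀, havg⟩ := exists_average_rpow_le hγ0 hr
  obtain ⟨C₁, hC₁, hadj⟩ := exists_abs_pairing_mul_le_adjacent hn hγ0 hγ1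
  refine ⟨2 ^ (n + 1) * 3 ^ ((n : ℝ) + γ) + C₁ * C₀ * 2 ^ ((n : ℝ) + γ), by positivity,
    fun K hK kJ mJ d m hm η hη => ?_⟩
  have hs := sideLen_pos kJ
  have hs' := sideLen_pos (kJ + d)
  have hr0 : 0 < r := by linarith
  have hlog : 0 ≤ Real.log ((2 : ℝ) ^ d) := Real.log_nonneg (one_le_pow₀ one_le_two)
  have hL : 1 ≤ (1 + Real.log ((2 : ℝ) ^ d)) ^ (if γ = 1 / r then 1 / r else 0) :=
    Real.one_le_rpow (by linarith) (by split_ifs <;> positivity)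
  refine (ENNReal.rpow_le_rpow (average_haar_sum_le hr kJ mJ η _) (by positivity)).trans ?_
  rw [ENNReal.ofReal_rpow_of_nonneg (by positivity) (by positivity)]
  apply ENNReal.ofReal_le_ofReal
  obtain ⟨i, hi⟩ := exists_abs_eq_inorm hn m
  have hi0 : m i ≠ 0 := fun h0 => by
    rw [h0, Int.cast_zero, abs_zero] at hi
    apply hm
    have := norm_eq_zero.1 hi.symm
    funext j
    exact Int.cast_eq_zero.1 (congrFun this j)
  rcases (Int.one_le_abs hi0).eq_or_lt' with h | h
  · obtain ⟨τ, hτ⟩ := hadj K hK kJ mJ d m hm i h η hη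
    have hM : inorm m = 1 := by rw [← hi]; exact_mod_cast h
    set P : ℝ := C₁ * sideLen kJ ^ (-(n : ℝ) / 2) with hP
    have hP0 : 0 < P := by positivity
    have hsum := average_pi_sum (n := n) (N := 2 ^ d) (by positivity) i τ
      fun j => (((j : ℝ) + 1) ^ (-γ)) ^ r
    push_cast at hsum
    have hS : (0 : ℝ) ≤ ((2 : ℝ) ^ d)⁻¹ * ∑ j ∈ Finset.range (2 ^ d), (((j : ℝ) + 1) ^ (-γ)) ^ r :=
      by positivity
    calc _ ≤ (((2 ^ d : ℝ) ^ n)⁻¹ * ∑ a : Fin n → Fin (2 ^ d),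
            (P * (((τ (a i) : ℕ) : ℝ) + 1) ^ (-γ)) ^ r) ^ (1 / r) := by
          gcongr ((_)⁻¹ * ∑ a, ?_ ^ r) ^ (1 / r) with a
          exact hτ a
      _ = P * ((2 ^ d : ℝ)⁻¹ * ∑ j ∈ Finset.range (2 ^ d),
            (((j : ℝ) + 1) ^ (-γ)) ^ r) ^ (1 / r) := by
          rw [← hsum]
          have e : ∀ a : Fin n → Fin (2 ^ d), (P * (((τ (a i) : ℕ) : ℝ) + 1) ^ (-γ)) ^ r =
              P ^ r * ((((τ (a i) : ℕ) : ℝ) + 1) ^ (-γ)) ^ r := fun a =>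
            Real.mul_rpow hP0.le (by positivity)
          simp only [e]
          rw [← Finset.mul_sum, mul_left_comm, Real.mul_rpow (by positivity) (by positivity),
            ← Real.rpow_mul hP0.le, mul_one_div_cancel hr0.ne', Real.rpow_one]
      _ ≤ P * (C₀ * ((2 : ℝ) ^ (-(d : ℝ))) ^ min γ (1 / r) *
          (1 + Real.log ((2 : ℝ) ^ d)) ^ (if γ = 1 / r then 1 / r else 0)) := by
          gcongr
          exact havg d
      _ = (C₁ * C₀ * 2 ^ ((n : ℝ) + γ)) * sideLen kJ ^ (-(n : ℝ) / 2) *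
          ((2 : ℝ) ^ (-(d : ℝ))) ^ min γ (1 / r) *
          (1 + Real.log ((2 : ℝ) ^ d)) ^ (if γ = 1 / r then 1 / r else 0) *
          (1 + inorm m) ^ (-(n : ℝ) - γ) := by
          have e : (2 : ℝ) ^ ((n : ℝ) + γ) * 2 ^ (-(n : ℝ) - γ) = 1 := by
            rw [← Real.rpow_add two_pos]; simp
          rw [hM, one_add_one_eq_two, hP]
          linear_combination (-C₁ * C₀ * sideLen kJ ^ (-(n : ℝ) / 2) *
            ((2 : ℝ) ^ (-(d : ℝ))) ^ min γ (1 / r) *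
            (1 + Real.log ((2 : ℝ) ^ d)) ^ (if γ = 1 / r then 1 / r else 0)) * e
      _ ≤ _ := by
          gcongr
          have : 0 < (2 : ℝ) ^ (n + 1) * 3 ^ ((n : ℝ) + γ) := by positivity
          linarith
  · have hM : 2 ≤ inorm m := by
      rw [← hi]
      exact_mod_cast (show 2 ≤ |m i| by omega)
    set D : ℝ := sideLen kJ * ((1 + inorm m) / 3) with hD
    have hD0 : 0 < D := by positivity
    set X : ℝ := 2 ^ (n + 1) * sideLen (kJ + d) ^ γ * sideLen kJ ^ ((n : ℝ) / 2) *
      D ^ (-(n : ℝ) - γ) with hX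
    have hX0 : 0 < X := by positivity
    have hXeq : X = 2 ^ (n + 1) * 3 ^ ((n : ℝ) + γ) * sideLen kJ ^ (-(n : ℝ) / 2) *
        ((2 : ℝ) ^ (-(d : ℝ))) ^ γ * (1 + inorm m) ^ (-(n : ℝ) - γ) := by
      have e1 : sideLen (kJ + d) = sideLen kJ * (2 : ℝ) ^ (-(d : ℝ)) := by
        rw [sideLen_add, Real.rpow_neg two_pos.le, Real.rpow_natCast, div_eq_mul_inv]
      have e2 : (3 : ℝ) ^ ((n : ℝ) + γ) = (3 ^ (-(n : ℝ) - γ))⁻¹ := by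
        rw [← Real.rpow_neg (by positivity)]; ring_nf
      have e3 : sideLen kJ ^ (-(n : ℝ) / 2) =
          sideLen kJ ^ γ * sideLen kJ ^ ((n : ℝ) / 2) * sideLen kJ ^ (-(n : ℝ) - γ) := by
        rw [← Real.rpow_add hs, ← Real.rpow_add hs]; ring_nf
      rw [hX, hD, Real.mul_rpow hs.le (by positivity), Real.div_rpow (by linarith) (by positivity),
        e1, Real.mul_rpow hs.le (by positivity), e2, e3]
      ring
    calc _ ≤ (((2 ^ d : ℝ) ^ n)⁻¹ * ∑ a : Fin n → Fin (2 ^ d), X ^ r) ^ (1 / r) := by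
          gcongr with a
          refine abs_pairing_mul_le_of_le_dist hK hγ0 hγ1 hη (fun x hx hx' =>
            hm (by simpa using eq_of_mem_dyadicCube hx (subcube_subset a hx'))) hD0
            fun x hx y hy => le_trans ?_ (le_dist_of_translate hx (subcube_subset a hy) i)
          rw [hi, hD]
          gcongr
          linarith
      _ = X := by
          rw [Finset.sum_const, Finset.card_univ, Fintype.card_fun, Fintype.card_fin,
            Fintype.card_fin, nsmul_eq_mul]
          push_cast
          rw [inv_mul_cancel_left₀ (by positivity), ← Real.rpow_mul hX0.le,
            mul_one_div_cancel hr0.ne', Real.rpow_one]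
      _ ≤ 2 ^ (n + 1) * 3 ^ ((n : ℝ) + γ) * sideLen kJ ^ (-(n : ℝ) / 2) *
          ((2 : ℝ) ^ (-(d : ℝ))) ^ min γ (1 / r) * 1 *
          (1 + inorm m) ^ (-(n : ℝ) - γ) := by
          rw [hXeq, mul_one]
          gcongr ?_ * ?_ * ?_
          · exact Real.rpow_le_rpow_of_exponent_ge (by positivity)
              (Real.rpow_le_one_of_one_le_of_nonpos one_le_two (by simp)) (min_le_left _ _)
      _ ≤ _ := by
          gcongr
          have : 0 < C₁ * C₀ * 2 ^ ((n : ℝ) + γ) := by positivity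
          linarith

end
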